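/- Let D_i, D_j be two disjoint disks with centers on a common horizontal line, p_i left of p_j, and let D_h, D_k, D_k' be disks such that {D_i, D_j, D_h}, {D_i, D_j, D_k}, {D_i, D_j, D_k'} are strongly convex independent sets, with D_h between D_i and D_j counterclockwise along the hull, and D_k, D_k' between D_j and D_i counterclockwise. Let v_ijh, v_ijk, v_ijk' be the unique points equidistant in signed distance from the respective triples, and let D_ijk, D_ijk' be the disks centered at v_ijk, v_ijk' tangent to the respective three disks. If v_ijk has smaller y-coordinate than v_ijk', and D_h is disjoint from D_ijk, then D_h is disjoint from D_ijk'. (Monotonicity: the family of admissible disks grows as the apex point moves up the bisector.) -/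

import Mathlib

open Metric Set
open scoped RealInnerProductSpace

noncomputable section

abbrev Pt : Type := EuclideanSpace ℝ (Fin 2)

/-- A closed disk in the plane, given by a center and a radius. -/
structure Disk : Type where
  center : Pt
  radius : ℝ

instance : DecidableEq Disk := Classical.decEq _

/-- The set of points of a disk (a closed ball). -/
def Disk.pts (D : Disk) : Set Pt := Metric.closedBall D.center D.radius

/-- The signed distance from a point `q` to a disk: `|q p| - r`. -/
def Disk.sd (D : Disk) (q : Pt) : ℝ := dist q D.center - D.radius

/-- Two disks are disjoint if the distance between their centers exceeds the sum of radii. -/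
def Disk.Disj (D E : Disk) : Prop := D.radius + E.radius < dist D.center E.center

/-- The union of the points of a set of disks. -/
def diskUnion (𝒟 : Set Disk) : Set Pt := ⋃ D ∈ 𝒟, D.pts

/-- The convex hull of a set of disks. -/
def diskHull (𝒟 : Set Disk) : Set Pt := convexHull ℝ (diskUnion 𝒟)

/-- The part of the boundary circle of `D` appearing on the boundary of the convex hull
of the disks of `𝒟`. -/
def hullArc (𝒟 : Set Disk) (D : Disk) : Set Pt :=
  Metric.sphere D.center D.radius ∩ frontier (diskHull 𝒟)

/-- Convex position: every disk's boundary contributes (at least) a point to the hull boundary. -/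
def ConvexPos (𝒟 : Set Disk) : Prop := ∀ D ∈ 𝒟, (hullArc 𝒟 D).Nonempty

/-- Strongly convex position: every disk's boundary contributes exactly one maximal (nonempty)
arc to the hull boundary, i.e. its trace on the hull boundary is nonempty and connected. -/
def StronglyConvexPos (𝒟 : Set Disk) : Prop := ∀ D ∈ 𝒟, IsConnected (hullArc 𝒟 D)

/-- An independent set of disks: pairwise disjoint. -/
def IndepSet (𝒟 : Set Disk) : Prop := ∀ A ∈ 𝒟, ∀ B ∈ 𝒟, A ≠ B → A.Disj B

/-- A strongly convex independent set. -/
def StronglyConvexIndep (𝒟 : Set Disk) : Prop := StronglyConvexPos 𝒟 ∧ IndepSet 𝒟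

/-- Cross product (orientation test) of `a - o` and `b - o`. -/
def cross (o a b : Pt) : ℝ := (a 0 - o 0) * (b 1 - o 1) - (a 1 - o 1) * (b 0 - o 0)

/-- `a, b, c` appear in strictly counterclockwise angular order around `o`. -/
def ccw3 (o a b c : Pt) : Prop := 0 < cross o a b ∧ 0 < cross o b c ∧ 0 < cross o c a

/-- `Dm` lies strictly between `Da` and `Db` in the counterclockwise order of the disks
along the boundary of the convex hull of `𝒟`. -/
def CCWBetween (𝒟 : Set Disk) (Da Dm Db : Disk) : Prop :=
  ∃ o ∈ interior (diskHull 𝒟), ∀ qa ∈ hullArc 𝒟 Da, ∀ qm ∈ hullArc 𝒟 Dm,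
    ∀ qb ∈ hullArc 𝒟 Db, ccw3 o qa qm qb

/-- A point regarded as a radius-zero disk. -/
def pointDisk (p : Pt) : Disk := ⟨p, 0⟩

/-- `m` is the midpoint of the circular arc `A` of a circle centered at `c`: some nonidentity
isometric involution of the plane (a reflection) fixes `c` and `m` and maps `A` onto itself. -/
def IsArcMidpoint (c : Pt) (A : Set Pt) (m : Pt) : Prop :=
  m ∈ A ∧ ∃ f : Pt ≃ᵢ Pt, f c = c ∧ f m = m ∧ (∀ x, f (f x) = x) ∧
    f ≠ IsometryEquiv.refl Pt ∧ f '' A = A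

lemma dist_sq' (x y : Pt) : dist x y ^ 2 = (x 0 - y 0)^2 + (x 1 - y 1)^2 := by
  rw [EuclideanSpace.dist_eq, Real.sq_sqrt (by positivity)]
  simp [Fin.sum_univ_two, Real.dist_eq, sq_abs]

/-- support function value of a disk -/
def hv (D : Disk) (a b : ℝ) : ℝ := a * D.center 0 + b * D.center 1 + D.radius

/-- extreme point -/
def zp (D : Disk) (a b : ℝ) : Pt := !₂[D.center 0 + D.radius * a, D.center 1 + D.radius * b]

lemma zp0 (D : Disk) (a b : ℝ) : zp D a b 0 = D.center 0 + D.radius * a := by simp [zp]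
lemma zp1 (D : Disk) (a b : ℝ) : zp D a b 1 = D.center 1 + D.radius * b := by simp [zp]

lemma zp_sphere (D : Disk) (a b : ℝ) (h : a^2+b^2=1) (hr : 0 ≤ D.radius) :
    zp D a b ∈ Metric.sphere D.center D.radius := by
  rw [Metric.mem_sphere]
  have h1 := dist_sq' (zp D a b) D.center
  rw [zp0, zp1] at h1
  have h2 : dist (zp D a b) D.center ^ 2 = D.radius ^ 2 := by
    rw [h1]; linear_combination D.radius^2 * h
  exact (pow_left_inj₀ dist_nonneg hr two_ne_zero).1 h2

lemma pts_subset (T : Set Disk) (D : Disk) (hD : D ∈ T) : D.pts ⊆ diskHull T := by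
  intro x hx
  apply subset_convexHull
  exact mem_biUnion hD hx

lemma zp_hull (T : Set Disk) (D : Disk) (hD : D ∈ T) (a b : ℝ) (h : a^2+b^2=1)
    (hr : 0 ≤ D.radius) : zp D a b ∈ diskHull T :=
  pts_subset T D hD (Metric.sphere_subset_closedBall (zp_sphere D a b h hr))

lemma pts_le (D : Disk) (q : Pt) (hq : q ∈ D.pts) (a b : ℝ) (h : a^2+b^2=1) :
    a * q 0 + b * q 1 ≤ hv D a b := by
  have h1 : dist q D.center ≤ D.radius := hq
  have h2 := dist_sq' q D.center
  have h0 : 0 ≤ dist q D.center := dist_nonneg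
  have h3 : a * (q 0 - D.center 0) + b * (q 1 - D.center 1) ≤ dist q D.center := by
    refine (le_abs_self _).trans (abs_le_of_sq_le_sq ?_ h0)
    rw [h2]
    nlinarith [sq_nonneg (a * (q 1 - D.center 1) - b * (q 0 - D.center 0))]
  unfold hv
  linarith

lemma hull_le (T : Set Disk) (a b M : ℝ) (h : a^2+b^2=1) (hM : ∀ E ∈ T, hv E a b ≤ M)
    (q : Pt) (hq : q ∈ diskHull T) : a * q 0 + b * q 1 ≤ M := by
  have hc : Convex ℝ {x : Pt | a * x 0 + b * x 1 ≤ M} := by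
    intro x hx y hy s t hs ht hst
    simp only [mem_ofPred_eq, PiLp.add_apply, PiLp.smul_apply, smul_eq_mul] at *
    have : t = 1 - s := by linarith
    subst this
    nlinarith
  have : diskHull T ⊆ {x : Pt | a * x 0 + b * x 1 ≤ M} := by
    apply convexHull_min _ hc
    intro x hx
    obtain ⟨E, hE, hx⟩ := mem_iUnion₂.1 hx
    exact (pts_le E x hx a b h).trans (hM E hE)
  exact this hq

lemma zp_arc (T : Set Disk) (D : Disk) (hD : D ∈ T) (a b : ℝ) (h : a^2+b^2=1)
    (hr : 0 ≤ D.radius) (hM : ∀ E ∈ T, hv E a b ≤ hv D a b) : zp D a b ∈ hullArc T D := by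
  refine ⟨zp_sphere D a b h hr, subset_closure (zp_hull T D hD a b h hr), ?_⟩
  intro hi
  have hcont : Continuous (fun s : ℝ => zp D a b + s • (!₂[a,b] : Pt)) := by fun_prop
  have hop := (isOpen_interior (s := diskHull T)).preimage hcont
  have h0 : (0:ℝ) ∈ (fun s : ℝ => zp D a b + s • (!₂[a,b] : Pt)) ⁻¹' interior (diskHull T) := by
    simpa using hi
  obtain ⟨ε, hε, hball⟩ := Metric.isOpen_iff.1 hop 0 h0
  have hm : (ε/2) ∈ Metric.ball (0:ℝ) ε := by
    rw [Metric.mem_ball, Real.dist_eq, sub_zero, abs_of_pos (by linarith)]; linarith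
  have := hull_le T a b _ h hM _ (interior_subset (hball hm))
  simp only [PiLp.add_apply, PiLp.smul_apply, smul_eq_mul, zp0, zp1, hv] at this
  simp at this
  have e : a * (D.center 0 + D.radius * a + ε/2*a) + b * (D.center 1 + D.radius * b + ε/2*b)
    = a * D.center 0 + b * D.center 1 + D.radius + ε/2 := by
    linear_combination (D.radius + ε/2) * h
  linarith

lemma support (S : Set Pt) (hS : Convex ℝ S) (o : Pt) (ho : o ∈ interior S) (q : Pt)
    (hq : q ∈ frontier S) : ∃ a b : ℝ, a^2+b^2=1 ∧
      ∀ x ∈ S, a * x 0 + b * x 1 ≤ a * q 0 + b * q 1 := by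
  obtain ⟨f, hf⟩ := geometric_hahn_banach_open_point hS.interior isOpen_interior hq.2
  have hfx : ∀ x : Pt, f x = f (!₂[1,0]) * x 0 + f (!₂[0,1]) * x 1 := by
    intro x
    have : x = x 0 • (!₂[1,0] : Pt) + x 1 • (!₂[0,1] : Pt) := by
      ext i; fin_cases i <;> simp
    conv_lhs => rw [this]
    rw [map_add, map_smul, map_smul]; simp; ring
  set A := f (!₂[1,0])
  set B := f (!₂[0,1])
  have hpos : 0 < A^2+B^2 := by
    rcases eq_or_lt_of_le (show 0 ≤ A^2+B^2 by positivity) with h | h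
    · exfalso
      have hA : A = 0 := by nlinarith
      have hB : B = 0 := by nlinarith
      have := hf o ho
      rw [hfx, hfx q, hA, hB] at this; simp at this
    · exact h
  have hle : ∀ x ∈ S, f x ≤ f q := by
    intro x hx
    have h1 : x ∈ closure (interior S) := by
      rw [hS.closure_interior_eq_closure_of_nonempty_interior ⟨o, ho⟩]
      exact subset_closure hx
    have h2 : closure (interior S) ⊆ {x | f x ≤ f q} :=
      closure_minimal (fun y hy => (hf y hy).le) (isClosed_le f.continuous continuous_const)
    exact h2 h1
  have hs : 0 < √(A^2+B^2) := Real.sqrt_pos.2 hpos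
  refine ⟨A / √(A^2+B^2), B / √(A^2+B^2), ?_, ?_⟩
  · rw [div_pow, div_pow, Real.sq_sqrt hpos.le]; field_simp
  · intro x hx
    have := hle x hx
    rw [hfx, hfx q] at this
    have e : ∀ y : Pt, A / √(A^2+B^2) * y 0 + B / √(A^2+B^2) * y 1
      = (A * y 0 + B * y 1) / √(A^2+B^2) := by intro y; field_simp
    rw [e, e]
    gcongr

lemma hull_support (T : Set Disk) (hT : ∀ E ∈ T, 0 ≤ E.radius) (o : Pt)
    (ho : o ∈ interior (diskHull T)) (q : Pt)
    (hq : q ∈ frontier (diskHull T)) : ∃ a b : ℝ, a^2+b^2=1 ∧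
      (∀ x ∈ diskHull T, a * x 0 + b * x 1 ≤ a * q 0 + b * q 1) ∧
      ∀ E ∈ T, hv E a b ≤ a * q 0 + b * q 1 := by
  obtain ⟨a, b, h, hx⟩ := support _ (convex_convexHull ℝ _) o ho q hq
  refine ⟨a, b, h, hx, fun E hE => ?_⟩
  have := hx _ (zp_hull T E hE a b h (hT E hE))
  rw [zp0, zp1] at this
  have e : a * (E.center 0 + E.radius * a) + b * (E.center 1 + E.radius * b) = hv E a b := by
    unfold hv; linear_combination E.radius * h
  linarith

lemma disj_ne (D E : Disk) (h : D.Disj E) (x y : Pt) (hx : x ∈ D.pts) (hy : y ∈ E.pts) :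
    ¬ (x 0 = y 0 ∧ x 1 = y 1) := by
  rintro ⟨h0, h1⟩
  have : x = y := by ext i; fin_cases i <;> simp [h0, h1]
  subst this
  have h2 : dist x D.center ≤ D.radius := hx
  have h3 : dist x E.center ≤ E.radius := hy
  have := dist_triangle_left D.center E.center x
  unfold Disk.Disj at h
  linarith

/-- betweenness -/
lemma bet (x y z : Pt) (l a b : ℝ) (hl0 : 0 < l) (hl1 : l < 1)
    (h0 : y 0 = (1-l) * x 0 + l * z 0) (h1 : y 1 = (1-l) * x 1 + l * z 1)
    (hx : a * x 0 + b * x 1 ≤ a * y 0 + b * y 1) (hz : a * z 0 + b * z 1 ≤ a * y 0 + b * y 1) :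
    a * x 0 + b * x 1 = a * y 0 + b * y 1 ∧ a * z 0 + b * z 1 = a * y 0 + b * y 1 := by
  have e : a * y 0 + b * y 1 = (1-l) * (a * x 0 + b * x 1) + l * (a * z 0 + b * z 1) := by
    rw [h0, h1]; ring
  generalize a * x 0 + b * x 1 = X at *
  generalize a * y 0 + b * y 1 = Y at *
  generalize a * z 0 + b * z 1 = Z at *
  constructor <;> nlinarith

lemma param (x y z : Pt) (h : cross x y z = 0) (hxz : ¬ (x 0 = z 0 ∧ x 1 = z 1)) :
    ∃ l : ℝ, y 0 = (1-l) * x 0 + l * z 0 ∧ y 1 = (1-l) * x 1 + l * z 1 := by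
  unfold cross at h
  by_cases h0 : x 0 = z 0
  · have h1 : z 1 - x 1 ≠ 0 := by
      intro h1; exact hxz ⟨h0, by linarith⟩
    refine ⟨(y 1 - x 1) / (z 1 - x 1), ?_, ?_⟩
    · have : (y 0 - x 0) * (z 1 - x 1) = 0 := by rw [h0] at h ⊢; linarith
      have := (mul_eq_zero.1 this).resolve_right h1
      rw [← h0]; linarith
    · field_simp; ring
  · have h1 : z 0 - x 0 ≠ 0 := by
      intro h1; exact h0 (by linarith)
    refine ⟨(y 0 - x 0) / (z 0 - x 0), ?_, ?_⟩
    · field_simp; ring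
    · field_simp; linarith

lemma arc_pts {T : Set Disk} {D : Disk} {q : Pt} (h : q ∈ hullArc T D) : q ∈ D.pts :=
  Metric.sphere_subset_closedBall h.1

lemma collin (T : Set Disk) (hT : ∀ E ∈ T, 0 ≤ E.radius) (o : Pt)
    (ho : o ∈ interior (diskHull T)) (X Y Z : Disk) (hX : X ∈ T) (hY : Y ∈ T) (hZ : Z ∈ T)
    (hXY : X.Disj Y) (hYZ : Y.Disj Z) (hXZ : X.Disj Z)
    (x y z : Pt) (hx : x ∈ hullArc T X) (hy : y ∈ hullArc T Y) (hz : z ∈ hullArc T Z)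
    (h : cross x y z = 0) : ∃ a b : ℝ, a^2+b^2=1 ∧ hv X a b = a * x 0 + b * x 1 ∧
      hv Y a b = a * y 0 + b * y 1 ∧ hv Z a b = a * z 0 + b * z 1 ∧
      hv X a b = hv Y a b ∧ hv X a b = hv Z a b := by
  have nxz := disj_ne _ _ hXZ x z (arc_pts hx) (arc_pts hz)
  have nxy := disj_ne _ _ hXY x y (arc_pts hx) (arc_pts hy)
  have nyz := disj_ne _ _ hYZ y z (arc_pts hy) (arc_pts hz)
  obtain ⟨l, h0, h1⟩ := param x y z h nxz
  have hxS := pts_subset T X hX (arc_pts hx)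
  have hyS := pts_subset T Y hY (arc_pts hy)
  have hzS := pts_subset T Z hZ (arc_pts hz)
  have key : ∃ a b : ℝ, a^2+b^2=1 ∧ a * x 0 + b * x 1 = a * y 0 + b * y 1 ∧
     a * z 0 + b * z 1 = a * y 0 + b * y 1 ∧ ∀ E ∈ T, hv E a b ≤ a * y 0 + b * y 1 := by
    rcases lt_trichotomy l 0 with hl | hl | hl
    · obtain ⟨a, b, hab, hs, hE⟩ := hull_support T hT o ho x hx.2
      have := bet y x z (-l/(1-l)) a b (div_pos (by linarith) (by linarith))
        ((div_lt_one (by linarith)).2 (by linarith))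
        (by rw [h0]; have : 1 - l ≠ 0 := by linarith
            field_simp; ring)
        (by rw [h1]; have : 1 - l ≠ 0 := by linarith
            field_simp; ring) (hs y hyS) (hs z hzS)
      exact ⟨a, b, hab, this.1.symm, by linarith, fun E h => by linarith [hE E h]⟩
    · subst hl; exact absurd ⟨by linarith, by linarith⟩ nxy
    · rcases lt_trichotomy l 1 with hl' | hl' | hl'
      · obtain ⟨a, b, hab, hs, hE⟩ := hull_support T hT o ho y hy.2
        have := bet x y z l a b hl hl' h0 h1 (hs x hxS) (hs z hzS)
        exact ⟨a, b, hab, this.1, this.2, hE⟩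
      · subst hl'; exact absurd ⟨by linarith, by linarith⟩ nyz
      · obtain ⟨a, b, hab, hs, hE⟩ := hull_support T hT o ho z hz.2
        have := bet x z y (1/l) a b (by positivity)
          ((div_lt_one (by linarith)).2 (by linarith))
          (by rw [h0]; field_simp; ring)
          (by rw [h1]; field_simp; ring) (hs x hxS) (hs y hyS)
        exact ⟨a, b, hab, by linarith, by linarith, fun E h => by linarith [hE E h]⟩
  obtain ⟨a, b, hab, e1, e2, hE⟩ := key
  have i1 := pts_le X x (arc_pts hx) a b hab
  have i2 := pts_le Y y (arc_pts hy) a b hab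
  have i3 := pts_le Z z (arc_pts hz) a b hab
  have j1 := hE X hX
  have j2 := hE Y hY
  have j3 := hE Z hZ
  exact ⟨a, b, hab, by linarith, by linarith, by linarith, by linarith, by linarith⟩

lemma cont_cross (y z : Pt) : Continuous (fun x : Pt => cross x y z) := by
  unfold cross; fun_prop

lemma path (A : Set Pt) (hA : IsPreconnected A) (f : Pt → ℝ) (hf : Continuous f) (p q : Pt)
    (hp : p ∈ A) (hq : q ∈ A) (h0 : ∀ x ∈ A, f x ≠ 0) (hfp : 0 < f p) : 0 < f q := by
  by_contra hh
  push Not at hh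
  obtain ⟨x, hx, hx0⟩ := hA.intermediate_value hq hp hf.continuousOn ⟨hh, hfp.le⟩
  exact h0 x hx hx0

lemma flipX (T : Set Disk) (hT : ∀ E ∈ T, 0 ≤ E.radius) (o : Pt)
    (ho : o ∈ interior (diskHull T)) (X Y Z : Disk) (hX : X ∈ T) (hY : Y ∈ T) (hZ : Z ∈ T)
    (hXY : X.Disj Y) (hYZ : Y.Disj Z) (hXZ : X.Disj Z) (hc : IsPreconnected (hullArc T X))
    (x x' y z : Pt) (hx : x ∈ hullArc T X) (hx' : x' ∈ hullArc T X)
    (hy : y ∈ hullArc T Y) (hz : z ∈ hullArc T Z)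
    (hN : ∀ a b : ℝ, a^2+b^2=1 → hv X a b = hv Y a b → hv X a b = hv Z a b →
      hv Y a b = a * y 0 + b * y 1 → hv Z a b = a * z 0 + b * z 1 → False)
    (h : 0 < cross x y z) : 0 < cross x' y z := by
  refine path _ hc _ (cont_cross y z) x x' hx hx' ?_ h
  intro w hw h0
  obtain ⟨a, b, hab, _, e2, e3, e4, e5⟩ :=
    collin T hT o ho X Y Z hX hY hZ hXY hYZ hXZ w y z hw hy hz h0
  exact hN a b hab e4 e5 e2 e3

lemma cross_rot (x y z : Pt) : cross x y z = cross y z x := by unfold cross; ring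

lemma arc_norm (T : Set Disk) (hT : ∀ E ∈ T, 0 ≤ E.radius) (o : Pt)
    (ho : o ∈ interior (diskHull T)) (D : Disk) (hD : D ∈ T) (hr : 0 < D.radius) (x : Pt)
    (hx : x ∈ hullArc T D) (a b : ℝ) (ha : a = (x 0 - D.center 0) / D.radius)
    (hb : b = (x 1 - D.center 1) / D.radius) :
    a^2+b^2=1 ∧ ∀ E ∈ T, hv E a b ≤ hv D a b := by
  have h1 : dist x D.center = D.radius := hx.1
  have h2 := dist_sq' x D.center
  rw [h1] at h2
  have hu : a^2+b^2=1 := by rw [ha, hb, div_pow, div_pow, ← add_div, ← h2]; field_simp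
  refine ⟨hu, ?_⟩
  obtain ⟨n, m, hn, _, hE⟩ := hull_support T hT o ho x hx.2
  have x0 : x 0 = D.center 0 + D.radius * a := by rw [ha]; field_simp; ring
  have x1 : x 1 = D.center 1 + D.radius * b := by rw [hb]; field_simp; ring
  have hd := hE D hD
  have h3 : 1 ≤ n * a + m * b := by
    unfold hv at hd
    rw [x0, x1] at hd
    have : D.radius * 1 ≤ D.radius * (n * a + m * b) := by linarith
    exact le_of_mul_le_mul_left this hr
  have h4 : (n-a)^2 + (m-b)^2 ≤ 0 := by nlinarith
  have h5 : n = a := by nlinarith [sq_nonneg (n-a), sq_nonneg (m-b)]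
  have h6 : m = b := by nlinarith [sq_nonneg (n-a), sq_nonneg (m-b)]
  subst h5 h6
  intro E hEE
  have := hE E hEE
  have e : n * x 0 + m * x 1 = hv D n m := by
    unfold hv; rw [x0, x1]; linear_combination D.radius * hu
  linarith

lemma chordY (α β c t x y : ℝ) (ht : 0 < t) (h1 : α^2+β^2=1) (h2 : c^2+t^2=1) (h3 : x^2+y^2=1)
    (hα : α < c) (hx : c < x) : ∃ l, 0 < l ∧ l < 1 ∧ c = (1-l)*α + l*x ∧
      -t < (1-l)*β+l*y ∧ (1-l)*β+l*y < t := by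
  have hp : 0 < x - α := by linarith
  have hl0 : 0 < (c-α)/(x-α) := div_pos (by linarith) hp
  have hl1 : (c-α)/(x-α) < 1 := (div_lt_one hp).2 (by linarith)
  have hc : c = (1-(c-α)/(x-α))*α + (c-α)/(x-α)*x := by field_simp; ring
  refine ⟨(c-α)/(x-α), hl0, hl1, hc, ?_⟩
  generalize (c-α)/(x-α) = l at *
  apply abs_lt.1
  apply abs_lt_of_sq_lt_sq _ ht.le
  have e : ((1-l)*β+l*y)^2 = t^2 - l*(1-l)*((x-α)^2+(y-β)^2) := by
    have : t^2 = 1 - ((1-l)*α + l*x)^2 := by rw [← hc]; linarith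
    rw [this]; linear_combination (1-l)*h1 + l*h3
  have : 0 < l*(1-l)*((x-α)^2+(y-β)^2) := by
    have : 0 < 1 - l := by linarith
    positivity
  linarith

lemma chordL (α β c t A B κ R : ℝ) (ht : 0 < t) (h1 : α^2+β^2=1) (h2 : c^2+t^2=1)
    (hα : α ≤ c) (hu : κ ≤ α*A+β*B) (hp : c*A+t*B < κ) (hm : c*A-t*B < κ)
    (hR : 0 < R) (hAB : A^2+B^2=R^2) (hκ : κ < R) : A / R < c := by
  have hz : (A/R)^2+(B/R)^2 = 1 := by rw [div_pow, div_pow, ← add_div, hAB]; field_simp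
  have hzR : A/R*A+B/R*B = R := by
    have : A/R*A+B/R*B = (A^2+B^2)/R := by ring
    rw [this, hAB]; field_simp
  have nw : ∀ x y : ℝ, x^2+y^2=1 → κ ≤ x*A+y*B → x ≠ c := by
    intro x y hxy h hx
    subst hx
    have : (y-t)*(y+t) = 0 := by linarith
    rcases mul_eq_zero.1 this with h' | h'
    · have : y = t := by linarith
      subst this; linarith
    · have : y = -t := by linarith
      subst this; linarith
  have a1 := nw α β h1 hu
  have a2 := nw (A/R) (B/R) hz (by linarith)
  by_contra hh
  push Not at hh
  obtain ⟨l, l0, l1, lc, y1, y2⟩ := chordY α β c t (A/R) (B/R) ht h1 h2 hz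
    (lt_of_le_of_ne hα a1) (lt_of_le_of_ne hh a2.symm)
  have e : c*A + ((1-l)*β+l*(B/R))*B = (1-l)*(α*A+β*B) + l*R := by
    linear_combination A * lc + l * hzR
  have f : κ ≤ c*A + ((1-l)*β+l*(B/R))*B := by rw [e]; nlinarith
  generalize (1-l)*β+l*(B/R) = Y at *
  rcases le_total 0 B with hB | hB <;> nlinarith

lemma coneL (α β c t a b r : ℝ) (hc : c < 0) (ht : 0 < t) (h2 : c^2+t^2=1) (h1 : α^2+β^2=1)
    (hα : α ≤ c) (hr : 0 ≤ r) (hP : r < c*a+t*b) (hM : r ≤ c*a-t*b) (hu : α*a+β*b ≤ r) :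
    α = c ∧ β = -t ∧ c*a-t*b = r := by
  obtain ⟨k, hk⟩ : ∃ k, α = k * c := ⟨α/c, (div_mul_cancel₀ α hc.ne).symm⟩
  obtain ⟨l, hl⟩ : ∃ l, β = l * t := ⟨β/t, by field_simp⟩
  subst hk hl
  have k1 : 1 ≤ k := by nlinarith
  have l1 : l^2 ≤ 1 := by
    by_contra h; push Not at h
    have : 0 < (l^2-1)*t^2 := by have : 0 < l^2-1 := by linarith
                                 positivity
    have : 0 ≤ (k^2-1)*c^2 := by have : 0 ≤ k^2-1 := by nlinarith
                                 positivity
    nlinarith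
  have hl := abs_le.1 ((sq_le_one_iff_abs_le_one l).1 l1)
  obtain ⟨p, hp⟩ : ∃ p, p = c*a+t*b-r := ⟨_, rfl⟩
  obtain ⟨m, hm⟩ : ∃ m, m = c*a-t*b-r := ⟨_, rfl⟩
  have p0 : 0 < p := by linarith
  have m0 : 0 ≤ m := by linarith
  have e : (k+l)*p + (k-l)*m + 2*(k-1)*r ≤ 0 := by rw [hp, hm]; nlinarith
  have e1 : 0 ≤ (k-l)*m := mul_nonneg (by linarith) m0
  have e2 : 0 ≤ (k-1)*r := mul_nonneg (by linarith) hr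
  have e3 : k + l ≤ 0 := by
    by_contra h; push Not at h
    have := mul_pos h p0
    linarith
  have k2 : k = 1 := by linarith
  have l2 : l = -1 := by linarith
  subst k2 l2
  refine ⟨by ring, by ring, by linarith⟩

structure Cfg (T : Set Disk) (Di Dj Dh : Disk) (o : Pt) (c t : ℝ) : Prop where
  hT : ∀ E ∈ T, E = Di ∨ E = Dj ∨ E = Dh
  hi : Di ∈ T
  hj : Dj ∈ T
  hh : Dh ∈ T
  rr : ∀ E ∈ T, 0 ≤ E.radius
  ho : o ∈ interior (diskHull T)
  con : ∀ E ∈ T, IsPreconnected (hullArc T E)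
  ind : ∀ A ∈ T, ∀ B ∈ T, A ≠ B → A.Disj B
  nij : Di ≠ Dj
  nih : Di ≠ Dh
  njh : Dj ≠ Dh
  hy : Di.center 1 = Dj.center 1
  hx : Di.center 0 < Dj.center 0
  ht : 0 < t
  hct : c^2+t^2=1
  hc : c * (Dj.center 0 - Di.center 0) = Di.radius - Dj.radius

section CfgSec

variable {T : Set Disk} {Di Dj Dh : Disk} {o : Pt} {c t : ℝ}

lemma Cfg.eqij (C : Cfg T Di Dj Dh o c t) (b : ℝ) : hv Dj c b = hv Di c b := by
  unfold hv; rw [C.hy]; linarith [C.hc]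

lemma Cfg.cls (C : Cfg T Di Dj Dh o c t) (a b : ℝ) (h : a^2+b^2=1) (e : hv Di a b = hv Dj a b) :
    a = c ∧ (b = t ∨ b = -t) := by
  unfold hv at e
  rw [C.hy] at e
  have hc := C.hc
  have hx := C.hx
  have : (a - c) * (Dj.center 0 - Di.center 0) = 0 := by linarith
  have ha : a = c := by
    rcases mul_eq_zero.1 this with h | h <;> linarith
  refine ⟨ha, ?_⟩
  subst ha
  have : (b-t)*(b+t) = 0 := by linarith [C.hct]
  rcases mul_eq_zero.1 this with h | h
  · left; linarith
  · right; linarith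

lemma Cfg.le (C : Cfg T Di Dj Dh o c t) (E : Disk) (hE : E ∈ T) (q : Pt) (hq : q ∈ hullArc T E)
    (b : ℝ) (hb : b = t ∨ b = -t) : c * q 0 + b * q 1 ≤ hv E c b := by
  apply pts_le E q (arc_pts hq)
  rcases hb with rfl | rfl <;> linarith [C.hct]

lemma Cfg.moveI (C : Cfg T Di Dj Dh o c t) (x x' y z : Pt) (hx : x ∈ hullArc T Di)
    (hx' : x' ∈ hullArc T Di) (hy : y ∈ hullArc T Dh) (hz : z ∈ hullArc T Dj)
    (hN : ∀ b, (b = t ∨ b = -t) → hv Dh c b = hv Di c b → c * y 0 + b * y 1 = hv Di c b →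
      c * z 0 + b * z 1 = hv Di c b → False)
    (h : 0 < cross x y z) : 0 < cross x' y z := by
  refine flipX T C.rr o C.ho Di Dh Dj C.hi C.hh C.hj (C.ind _ C.hi _ C.hh C.nih)
    (C.ind _ C.hh _ C.hj C.njh.symm) (C.ind _ C.hi _ C.hj C.nij) (C.con _ C.hi) x x' y z hx hx' hy hz
    ?_ h
  intro a b hab e1 e2 e3 e4
  obtain ⟨rfl, hb⟩ := C.cls a b hab e2
  exact hN b hb (by linarith) (by linarith) (by linarith)

lemma Cfg.moveJ (C : Cfg T Di Dj Dh o c t) (x y z z' : Pt) (hx : x ∈ hullArc T Di)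
    (hz' : z' ∈ hullArc T Dj) (hy : y ∈ hullArc T Dh) (hz : z ∈ hullArc T Dj)
    (hN : ∀ b, (b = t ∨ b = -t) → hv Dh c b = hv Di c b → c * y 0 + b * y 1 = hv Di c b →
      c * x 0 + b * x 1 = hv Di c b → False)
    (h : 0 < cross x y z) : 0 < cross x y z' := by
  rw [← cross_rot] at h ⊢
  refine flipX T C.rr o C.ho Dj Di Dh C.hj C.hi C.hh (C.ind _ C.hj _ C.hi C.nij.symm)
    (C.ind _ C.hi _ C.hh C.nih) (C.ind _ C.hj _ C.hh C.njh) (C.con _ C.hj) z z' x y hz hz' hx hy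
    ?_ h
  intro a b hab e1 e2 e3 e4
  obtain ⟨rfl, hb⟩ := C.cls a b hab e1.symm
  exact hN b hb (by linarith) (by linarith) (by linarith)

lemma Cfg.moveH (C : Cfg T Di Dj Dh o c t) (x y y' z : Pt) (hx : x ∈ hullArc T Di)
    (hy' : y' ∈ hullArc T Dh) (hy : y ∈ hullArc T Dh) (hz : z ∈ hullArc T Dj)
    (hN : ∀ b, (b = t ∨ b = -t) → hv Dh c b = hv Di c b → c * z 0 + b * z 1 = hv Di c b →
      c * x 0 + b * x 1 = hv Di c b → False)
    (h : 0 < cross x y z) : 0 < cross x y' z := by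
  rw [cross_rot] at h ⊢
  refine flipX T C.rr o C.ho Dh Dj Di C.hh C.hj C.hi (C.ind _ C.hh _ C.hj C.njh.symm)
    (C.ind _ C.hj _ C.hi C.nij.symm) (C.ind _ C.hh _ C.hi C.nih.symm) (C.con _ C.hh) y y' z x hy hy'
    hz hx ?_ h
  intro a b hab e1 e2 e3 e4
  obtain ⟨rfl, hb⟩ := C.cls a b hab (by linarith)
  exact hN b hb (by linarith) (by linarith) (by linarith)

lemma Cfg.hm (C : Cfg T Di Dj Dh o c t) : c^2+(-t)^2=1 := by linarith [C.hct]

lemma Cfg.zi (C : Cfg T Di Dj Dh o c t) (g : hv Dh c (-t) ≤ hv Di c (-t)) :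
    zp Di c (-t) ∈ hullArc T Di := by
  refine zp_arc T Di C.hi c (-t) C.hm (C.rr _ C.hi) ?_
  intro E hE
  rcases C.hT E hE with rfl | rfl | rfl
  · exact le_rfl
  · exact (C.eqij _).le
  · exact g

lemma Cfg.zj (C : Cfg T Di Dj Dh o c t) (g : hv Dh c (-t) ≤ hv Di c (-t)) :
    zp Dj c (-t) ∈ hullArc T Dj := by
  refine zp_arc T Dj C.hj c (-t) C.hm (C.rr _ C.hj) ?_
  intro E hE
  rw [C.eqij]
  rcases C.hT E hE with rfl | rfl | rfl
  · exact le_rfl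
  · exact (C.eqij _).le
  · exact g

lemma Cfg.zcross (C : Cfg T Di Dj Dh o c t) (q : Pt) (hq : c * q 0 + (-t) * q 1 < hv Di c (-t)) :
    cross (zp Di c (-t)) q (zp Dj c (-t)) < 0 := by
  have e : cross (zp Di c (-t)) q (zp Dj c (-t))
     = (Dj.center 0 - Di.center 0) * t * (c * q 0 + (-t) * q 1 - hv Di c (-t)) := by
    unfold cross hv
    rw [zp0, zp1, zp0, zp1, ← C.hy]
    have hc := C.hc
    have : Dj.radius = Di.radius - c * (Dj.center 0 - Di.center 0) := by linarith
    rw [this]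
    have hct := C.hct
    have e2 : c^2 = 1 - t^2 := by linarith
    ring_nf
    simp only [e2]
    ring
  rw [e]
  have := C.ht
  have := C.hx
  exact mul_neg_of_pos_of_neg (mul_pos (by linarith) C.ht) (by linarith)

/-- three points on a line with normal `(c,b)` -/
lemma cross_zero (c b M : ℝ) (h : c^2+b^2=1) (x y z : Pt) (hx : c * x 0 + b * x 1 = M)
    (hy : c * y 0 + b * y 1 = M) (hz : c * z 0 + b * z 1 = M) : cross x y z = 0 := by
  have h1 : c * cross x y z = 0 := by
    unfold cross
    linear_combination (hx - hy) * (x 1 - z 1) - (hx - hz) * (x 1 - y 1)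
  have h2 : b * cross x y z = 0 := by
    unfold cross
    linear_combination (hx - hz) * (x 0 - y 0) - (hx - hy) * (x 0 - z 0)
  linear_combination - cross x y z * h + c * h1 + b * h2

lemma Cfg.G1 (C : Cfg T Di Dj Dh o c t) (x y z : Pt) (hx : x ∈ hullArc T Di)
    (hy : y ∈ hullArc T Dh) (hz : z ∈ hullArc T Dj) (h : 0 < cross x y z)
    (g : hv Dh c (-t) < hv Di c (-t)) : False := by
  have zi := C.zi g.le
  have zj := C.zj g.le
  have neg := C.zcross y (lt_of_le_of_lt (C.le Dh C.hh y hy (-t) (Or.inr rfl)) g)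
  have nm : ∀ b, (b = t ∨ b = -t) → hv Dh c b = hv Di c b → b = t := by
    rintro b (rfl | rfl) e
    · rfl
    · linarith
  by_cases hon : hv Dh c t = hv Di c t ∧ c * y 0 + t * y 1 = hv Di c t
  · obtain ⟨g0, hy0⟩ := hon
    have lei : ∀ x ∈ hullArc T Di, c * x 0 + t * x 1 ≤ hv Di c t :=
      fun x hx => C.le Di C.hi x hx t (Or.inl rfl)
    have lej : ∀ x ∈ hullArc T Dj, c * x 0 + t * x 1 ≤ hv Di c t :=
      fun x hx => (C.le Dj C.hj x hx t (Or.inl rfl)).trans (C.eqij t).le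
    -- on-line formulas
    have fz : ∀ p q : Pt, c * q 0 + t * q 1 = hv Di c t →
        t * cross p y q = (q 0 - y 0) * (c * p 0 + t * p 1 - hv Di c t) := by
      intro p q hq
      unfold cross
      linear_combination (y 0 - p 0) * hq + (p 0 - q 0) * hy0
    have fx : ∀ p q : Pt, c * p 0 + t * p 1 = hv Di c t →
        t * cross p y q = (y 0 - p 0) * (c * q 0 + t * q 1 - hv Di c t) := by
      intro p q hp
      unfold cross
      linear_combination (q 0 - y 0) * hp + (p 0 - q 0) * hy0
    rcases lt_or_eq_of_le (lei x hx) with hxo | hxo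
    · have s1 : 0 < cross x y (zp Dj c (-t)) := by
        refine C.moveJ x y z _ hx zj hy hz ?_ h
        intro b hb e _ e2
        rw [nm b hb e] at e2; linarith
      rcases lt_or_eq_of_le (lej _ zj) with ho | ho
      · have := C.moveI x _ y _ hx zi hy zj (by
          intro b hb e _ e2
          rw [nm b hb e] at e2; linarith) s1
        linarith
      · have a1 := fz x _ ho
        have a2 := fz (zp Di c (-t)) _ ho
        have a3 := mul_pos C.ht s1
        have a4 := mul_neg_of_pos_of_neg C.ht neg
        have a5 := lei _ zi
        rw [a1] at a3; rw [a2] at a4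
        nlinarith
    · rcases lt_or_eq_of_le (lej z hz) with hzo | hzo
      · have s1 : 0 < cross (zp Di c (-t)) y z := by
          refine C.moveI x _ y z hx zi hy hz ?_ h
          intro b hb e _ e2
          rw [nm b hb e] at e2; linarith
        rcases lt_or_eq_of_le (lei _ zi) with ho | ho
        · have := C.moveJ _ y z _ zi zj hy hz (by
            intro b hb e _ e2
            rw [nm b hb e] at e2; linarith) s1
          linarith
        · have a1 := fx _ z ho
          have a2 := fx _ (zp Dj c (-t)) ho
          have a3 := mul_pos C.ht s1
          have a4 := mul_neg_of_pos_of_neg C.ht neg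
          have a5 := lej _ zj
          rw [a1] at a3; rw [a2] at a4
          nlinarith
      · have := cross_zero c t _ C.hct x y z hxo hy0 hzo
        linarith
  · have hN : ∀ b, (b = t ∨ b = -t) → hv Dh c b = hv Di c b →
        c * y 0 + b * y 1 = hv Di c b → False := by
      intro b hb e e2
      have := nm b hb e
      subst this
      exact hon ⟨e, e2⟩
    have s1 := C.moveI x _ y z hx zi hy hz (fun b hb e e2 _ => hN b hb e e2) h
    have s2 := C.moveJ _ y z _ zi zj hy hz (fun b hb e e2 _ => hN b hb e e2) s1
    linarith

lemma Cfg.zh (C : Cfg T Di Dj Dh o c t) (b : ℝ) (hb : b = t ∨ b = -t)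
    (g : hv Di c b ≤ hv Dh c b) :
    zp Dh c b ∈ hullArc T Dh := by
  refine zp_arc T Dh C.hh c b ?_ (C.rr _ C.hh) ?_
  · rcases hb with rfl | rfl <;> linarith [C.hct]
  intro E hE
  rcases C.hT E hE with rfl | rfl | rfl
  · exact g
  · rw [C.eqij]; exact g
  · exact le_rfl

lemma Cfg.G2 (C : Cfg T Di Dj Dh o c t) (x y z : Pt) (hx : x ∈ hullArc T Di)
    (hy : y ∈ hullArc T Dh) (hz : z ∈ hullArc T Dj) (h : 0 < cross x y z)
    (g : hv Dh c (-t) = hv Di c (-t)) (gp : hv Di c t < hv Dh c t) (hr : 0 < Dh.radius) :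
    False := by
  have zi := C.zi g.le
  have zj := C.zj g.le
  have nm : ∀ b, (b = t ∨ b = -t) → hv Dh c b = hv Di c b → b = -t := by
    rintro b (rfl | rfl) e
    · linarith
    · rfl
  have P : ∀ y ∈ hullArc T Dh, c * y 0 + (-t) * y 1 < hv Di c (-t) → 0 < cross x y z → False := by
    intro y hy ho h
    have hN : ∀ b, (b = t ∨ b = -t) → hv Dh c b = hv Di c b →
        c * y 0 + b * y 1 = hv Di c b → False := by
      intro b hb e e2
      have := nm b hb e
      subst this
      linarith
    have s1 := C.moveI x _ y z hx zi hy hz (fun b hb e e2 _ => hN b hb e e2) h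
    have s2 := C.moveJ _ y z _ zi zj hy hz (fun b hb e e2 _ => hN b hb e e2) s1
    linarith [C.zcross y ho]
  rcases lt_or_eq_of_le ((C.le Dh C.hh y hy (-t) (Or.inr rfl)).trans g.le) with ho | ho
  · exact P y hy ho h
  · have zh := C.zh t (Or.inl rfl) gp.le
    refine P _ zh ?_ (C.moveH x y _ z hx zh hy hz ?_ h)
    · rw [zp0, zp1, ← g]
      unfold hv
      have := C.ht
      have : 0 < Dh.radius * t^2 := by positivity
      nlinarith [C.hct]
    · intro b hb e e1 e2
      have := nm b hb e
      subst this
      have := cross_zero c (-t) _ C.hm x y z e2 ho e1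
      linarith

lemma Cfg.G3 (C : Cfg T Di Dj Dh o c t) (x z : Pt) (hx : x ∈ hullArc T Di)
    (hz : z ∈ hullArc T Dj)
    (g : hv Di c (-t) < hv Dh c (-t)) (gp : hv Di c t < hv Dh c t) (hr : 0 < Dh.radius) :
    False := by
  have ht := C.ht
  have hct := C.hct
  have hd : 0 < Dj.center 0 - Di.center 0 := by linarith [C.hx]
  have hc := C.hc
  have ri := C.rr _ C.hi
  have rj := C.rr _ C.hj
  have hy := C.hy
  have ej1 := C.eqij t
  have ej2 := C.eqij (-t)
  -- strict direction for `Di`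
  have Ri : Dh.radius + Di.radius < dist Di.center Dh.center := by
    have := C.ind _ C.hi _ C.hh C.nih; unfold Disk.Disj at this; linarith
  have Rj : Dh.radius + Dj.radius < dist Dj.center Dh.center := by
    have := C.ind _ C.hj _ C.hh C.njh; unfold Disk.Disj at this; linarith
  have Qi := dist_sq' Di.center Dh.center
  have Qj := dist_sq' Dj.center Dh.center
  set R := dist Di.center Dh.center
  set R' := dist Dj.center Dh.center
  obtain ⟨A, hA⟩ : ∃ A, A = Di.center 0 - Dh.center 0 := ⟨_, rfl⟩
  obtain ⟨B, hB⟩ : ∃ B, B = Di.center 1 - Dh.center 1 := ⟨_, rfl⟩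
  obtain ⟨A', hA'⟩ : ∃ A, A = Dj.center 0 - Dh.center 0 := ⟨_, rfl⟩
  obtain ⟨B', hB'⟩ : ∃ B, B = Dj.center 1 - Dh.center 1 := ⟨_, rfl⟩
  rw [← hA, ← hB] at Qi
  rw [← hA', ← hB'] at Qj
  have R0 : 0 < R := by linarith
  have R0' : 0 < R' := by linarith
  have x1 : A / R < c := by
    obtain ⟨α, β, hu, _, hE⟩ := hull_support T C.rr o C.ho x hx.2
    have h1 := pts_le Di x (arc_pts hx) α β hu
    have h2 := hE Dj C.hj
    have h3 := hE Dh C.hh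
    unfold hv at *
    refine chordL α β c t A B (Dh.radius - Di.radius) R ht hu hct ?_ ?_ ?_ ?_ R0 Qi.symm (by linarith)
    · by_contra hh
      push Not at hh
      have := mul_pos (sub_pos.2 hh) hd
      rw [← hy] at h2
      nlinarith
    · rw [hA, hB]; linarith
    · rw [hA, hB]; linarith
    · rw [hA, hB]; linarith
  have x2 : c < A' / R' := by
    obtain ⟨α, β, hu, _, hE⟩ := hull_support T C.rr o C.ho z hz.2
    have h1 := pts_le Dj z (arc_pts hz) α β hu
    have h2 := hE Di C.hi
    have h3 := hE Dh C.hh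
    unfold hv at *
    have := chordL (-α) β (-c) t (-A') B' (Dh.radius - Dj.radius) R' ht (by linarith) (by linarith)
      ?_ ?_ ?_ ?_ R0' (by linarith) (by linarith)
    · rw [neg_div] at this; linarith
    · by_contra hh
      push Not at hh
      have := mul_pos (sub_pos.2 hh) hd
      rw [hy] at h2
      nlinarith
    · rw [hA', hB']; linarith
    · rw [hA', hB']; linarith
    · rw [hA', hB']; linarith
  have u1 : (A/R)^2+(B/R)^2 = 1 := by
    rw [div_pow, div_pow, ← add_div, ← Qi, div_self (by positivity)]
  have u2 : (A'/R')^2+(B'/R')^2 = 1 := by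
    rw [div_pow, div_pow, ← add_div, ← Qj, div_self (by positivity)]
  have s1 : hv Dh (A/R) (B/R) < hv Di (A/R) (B/R) := by
    have : A/R*A+B/R*B = R := by
      have : A/R*A+B/R*B = (A^2+B^2)/R := by ring
      rw [this, ← Qi]; field_simp
    have e : hv Di (A/R) (B/R) - hv Dh (A/R) (B/R) = A/R*A+B/R*B + Di.radius - Dh.radius := by
      unfold hv; linear_combination - (A/R) * hA - (B/R) * hB
    linarith
  have s2 : hv Dh (A'/R') (B'/R') < hv Dj (A'/R') (B'/R') := by
    have : A'/R'*A'+B'/R'*B' = R' := by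
      have : A'/R'*A'+B'/R'*B' = (A'^2+B'^2)/R' := by ring
      rw [this, ← Qj]; field_simp
    have e : hv Dj (A'/R') (B'/R') - hv Dh (A'/R') (B'/R')
        = A'/R'*A'+B'/R'*B' + Dj.radius - Dh.radius := by
      unfold hv; linear_combination - (A'/R') * hA' - (B'/R') * hB'
    linarith
  generalize A/R = a1 at *
  generalize B/R = b1 at *
  generalize A'/R' = a2 at *
  generalize B'/R' = b2 at *
  obtain ⟨l, l0, l1, lc, y1, y2⟩ := chordY a1 b1 c t a2 b2 ht u1 hct u2 x1 x2
  have zp' := C.zh t (Or.inl rfl) gp.le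
  have zm' := C.zh (-t) (Or.inr rfl) g.le
  have hd2 : 0 < a2 - a1 := by linarith
  have key := path _ (C.con _ C.hh)
    (fun p : Pt => ((p 1 - Dh.center 1)/Dh.radius - b1) * (a2-a1)
      - ((p 0 - Dh.center 0)/Dh.radius - a1) * (b2 - b1)) (by fun_prop) _ _ zp' zm' ?_ ?_
  · simp only [zp0, zp1, add_sub_cancel_left] at key
    rw [mul_div_cancel_left₀ _ hr.ne', mul_div_cancel_left₀ _ hr.ne'] at key
    have e : (-t - b1) * (a2-a1) - (c - a1) * (b2 - b1)
      = (a2-a1) * (-t - ((1-l)*b1+l*b2)) := by rw [lc]; ring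
    rw [e] at key
    have := (mul_pos_iff_of_pos_left hd2).1 key
    linarith
  · intro p hp h0
    obtain ⟨hu, hE⟩ := arc_norm T C.rr o C.ho Dh C.hh hr p hp _ _ rfl rfl
    simp only at h0
    generalize (p 0 - Dh.center 0)/Dh.radius = α at *
    generalize (p 1 - Dh.center 1)/Dh.radius = β at *
    obtain ⟨μ, hμ⟩ : ∃ μ, μ = (α - a1)/(a2-a1) := ⟨_, rfl⟩
    have e1 : α = a1 + μ * (a2-a1) := by rw [hμ]; field_simp; ring
    have e2 : β = b1 + μ * (b2-b1) := by
      have : (a2 - a1) * (β - (b1 + μ * (b2-b1))) = 0 := by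
        rw [e1] at h0; linarith
      have := (mul_eq_zero.1 this).resolve_left hd2.ne'
      linarith
    have e3 : (μ * (1-μ)) * ((a2-a1)^2+(b2-b1)^2) = 0 := by
      rw [e1, e2] at hu; linear_combination (1-μ)*u1 + μ*u2 - hu
    rcases mul_eq_zero.1 e3 with h | h
    · rcases mul_eq_zero.1 h with h | h
      · have i1 : α = a1 := by rw [e1, h]; ring
        have i2 : β = b1 := by rw [e2, h]; ring
        have := hE _ C.hi
        rw [i1, i2] at this; linarith
      · have h : μ = 1 := by linarith
        have i1 : α = a2 := by rw [e1, h]; ring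
        have i2 : β = b2 := by rw [e2, h]; ring
        have := hE _ C.hj
        rw [i1, i2] at this; linarith
    · have : 0 < (a2-a1)^2+(b2-b1)^2 := by positivity
      linarith
  · simp only [zp0, zp1, add_sub_cancel_left]
    rw [mul_div_cancel_left₀ _ hr.ne', mul_div_cancel_left₀ _ hr.ne']
    have e : (t - b1) * (a2-a1) - (c - a1) * (b2 - b1)
      = (a2-a1) * (t - ((1-l)*b1+l*b2)) := by rw [lc]; ring
    rw [e]
    exact mul_pos hd2 (by linarith)

set_option maxHeartbeats 1000000 in
lemma Cfg.G0 (C : Cfg T Di Dj Dh o c t) (x y z : Pt) (hx : x ∈ hullArc T Di)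
    (hy : y ∈ hullArc T Dh) (hz : z ∈ hullArc T Dj) (h : 0 < cross x y z)
    (g : hv Di c (-t) ≤ hv Dh c (-t)) (gp : hv Di c t < hv Dh c t) (hr : Dh.radius = 0) :
    False := by
  have ht := C.ht
  have hct := C.hct
  have hd : 0 < Dj.center 0 - Di.center 0 := by linarith [C.hx]
  have hc := C.hc
  have ri := C.rr _ C.hi
  have rj := C.rr _ C.hj
  have hyy := C.hy
  have ej1 := C.eqij t
  have ej2 := C.eqij (-t)
  have yc : y = Dh.center := by
    have : dist y Dh.center = Dh.radius := hy.1
    rw [hr] at this; exact dist_eq_zero.1 this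
  have lx1 := C.le _ C.hi x hx t (Or.inl rfl)
  have lx2 := C.le _ C.hi x hx (-t) (Or.inr rfl)
  have lz1 := C.le _ C.hj z hz t (Or.inl rfl)
  have lz2 := C.le _ C.hj z hz (-t) (Or.inr rfl)
  rcases lt_trichotomy c 0 with c0 | c0 | c0
  · obtain ⟨α, β, hu, _, hE⟩ := hull_support T C.rr o C.ho x hx.2
    have h1 := pts_le Di x (arc_pts hx) α β hu
    have h2 := hE Dj C.hj
    have h3 := hE Dh C.hh
    have hα : α ≤ c := by
      by_contra hh
      push Not at hh
      have := mul_pos (sub_pos.2 hh) hd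
      unfold hv at *
      rw [← hyy] at h2
      nlinarith
    obtain ⟨r1, r2, r3⟩ := coneL α β c t (Dh.center 0 - Di.center 0) (Dh.center 1 - Di.center 1)
      Di.radius c0 ht hct hu hα ri (by unfold hv at *; linarith) (by unfold hv at *; linarith)
      (by unfold hv at *; linarith)
    rw [r1, r2] at h3
    have f1 : c * (y 0 - x 0) + t * (y 1 - x 1) > 0 := by
      rw [yc]; unfold hv at *; linarith
    have f2 : c * (y 0 - x 0) - t * (y 1 - x 1) = 0 := by
      rw [yc]; unfold hv at *; linarith
    have f3 : 0 ≤ t * (z 1 - x 1) - c * (z 0 - x 0) := by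
      rw [yc] at f2; unfold hv at *; linarith
    have f4 : y 0 - x 0 < 0 := by nlinarith
    have f5 : t * cross x y z = (y 0 - x 0) * (t * (z 1 - x 1) - c * (z 0 - x 0)) := by
      unfold cross; linear_combination (z 0 - x 0) * f2
    have := mul_pos ht h
    rw [f5] at this
    nlinarith
  · subst c0; unfold hv at *; linarith
  · obtain ⟨α, β, hu, _, hE⟩ := hull_support T C.rr o C.ho z hz.2
    have h1 := pts_le Dj z (arc_pts hz) α β hu
    have h2 := hE Di C.hi
    have h3 := hE Dh C.hh
    have hα : -α ≤ -c := by
      by_contra hh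
      push Not at hh
      have := mul_pos (sub_pos.2 hh) hd
      unfold hv at *
      rw [hyy] at h2
      nlinarith
    obtain ⟨r1, r2, r3⟩ := coneL (-α) β (-c) t (-(Dh.center 0 - Dj.center 0))
      (Dh.center 1 - Dj.center 1)
      Dj.radius (by linarith) ht (by linarith) (by linarith) hα rj (by unfold hv at *; linarith)
      (by unfold hv at *; linarith)
      (by unfold hv at *; linarith)
    have r1 : α = c := by linarith
    rw [r1, r2] at h3
    have f1 : c * (y 0 - z 0) + t * (y 1 - z 1) > 0 := by
      rw [yc]; unfold hv at *; linarith
    have f2 : c * (y 0 - z 0) - t * (y 1 - z 1) = 0 := by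
      rw [yc]; unfold hv at *; linarith
    have f3 : 0 ≤ t * (x 1 - z 1) - c * (x 0 - z 0) := by
      rw [yc] at f2; unfold hv at *; linarith
    have f4 : 0 < y 0 - z 0 := by nlinarith
    have f5 : t * cross x y z = - ((y 0 - z 0) * (t * (x 1 - z 1) - c * (x 0 - z 0))) := by
      unfold cross; linear_combination - (x 0 - z 0) * f2
    have := mul_pos ht h
    rw [f5] at this
    nlinarith

lemma Cfg.main (C : Cfg T Di Dj Dh o c t) (x y z : Pt) (hx : x ∈ hullArc T Di)
    (hy : y ∈ hullArc T Dh) (hz : z ∈ hullArc T Dj) (h : 0 < cross x y z) :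
    hv Di c (-t) ≤ hv Dh c (-t) ∧ hv Dh c t ≤ hv Di c t := by
  have g : hv Di c (-t) ≤ hv Dh c (-t) := by
    by_contra hh; push Not at hh
    exact C.G1 x y z hx hy hz h hh
  refine ⟨g, ?_⟩
  by_contra gp; push Not at gp
  rcases eq_or_lt_of_le (C.rr _ C.hh) with hr | hr
  · exact C.G0 x y z hx hy hz h g gp hr.symm
  · rcases eq_or_lt_of_le g with g | g
    · exact C.G2 x y z hx hy hz h g.symm gp hr
    · exact C.G3 x z hx hz g gp hr

end CfgSec

lemma arc_mono {T 𝒟 : Set Disk} (hT : T ⊆ 𝒟) {D : Disk} (hD : D ∈ T) {q : Pt}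
    (hq : q ∈ hullArc 𝒟 D) : q ∈ hullArc T D := by
  refine ⟨hq.1, subset_closure (pts_subset T D hD (arc_pts hq)), fun hi => hq.2.2 ?_⟩
  exact interior_mono (convexHull_mono (biUnion_mono hT fun _ _ => subset_rfl)) hi

lemma tri_int {S : Set Pt} (hS : Convex ℝ S) (o x y z : Pt) (hx : x ∈ S) (hy : y ∈ S) (hz : z ∈ S)
    (h : ccw3 o x y z) : o ∈ interior S := by
  rw [mem_interior]
  refine ⟨{p | ccw3 p x y z}, ?_, ?_, h⟩
  · rintro p ⟨h1, h2, h3⟩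
    have hs : 0 < cross p x y + cross p y z + cross p z x := by linarith
    obtain ⟨s, hs'⟩ : ∃ s, s = cross p x y + cross p y z + cross p z x := ⟨_, rfl⟩
    rw [← hs'] at hs
    have e : p = (cross p y z / s) • x + (cross p z x / s) • y + (cross p x y / s) • z := by
      have k0 : s * p 0 = cross p y z * x 0 + cross p z x * y 0 + cross p x y * z 0 := by
        rw [hs']; unfold cross; ring
      have k1 : s * p 1 = cross p y z * x 1 + cross p z x * y 1 + cross p x y * z 1 := by
        rw [hs']; unfold cross; ring
      ext i
      fin_cases i
      · simp; field_simp; linarith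
      · simp; field_simp; linarith
    rw [e]
    have := hS.sum_mem (t := Finset.univ) (w := ![cross p y z / s, cross p z x / s, cross p x y / s])
      (z := ![x, y, z]) ?_ ?_ ?_
    · simpa [Fin.sum_univ_three] using this
    · intro i _; fin_cases i <;> simp <;> positivity
    · simp [Fin.sum_univ_three]; field_simp; linarith
    · intro i _; fin_cases i <;> simp [hx, hy, hz]
  · have : {p | ccw3 p x y z} = {p : Pt | 0 < cross p x y} ∩ ({p | 0 < cross p y z} ∩ {p | 0 < cross p z x}) := by
      ext p; rfl
    rw [this]
    exact (isOpen_lt continuous_const (cont_cross _ _)).inter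
      ((isOpen_lt continuous_const (cont_cross _ _)).inter
        (isOpen_lt continuous_const (cont_cross _ _)))

/-- the analytic computation along the bisector -/
lemma bisector (d t ri rj y s y' s' m b : ℝ) (ht : 0 < t)
    (hτ : d ≤ 2 * s + ri + rj) (hτ' : d ≤ 2 * s' + ri + rj) (hd : 0 < d)
    (e : y^2 = t^2 * (s + (ri+rj)/2)^2 - d^2*t^2/4)
    (e' : y'^2 = t^2 * (s' + (ri+rj)/2)^2 - d^2*t^2/4) (hlt : y < y')
    (gm : 0 ≤ m - t * b) (gp : m + t * b ≤ 0) : m * (s' - s) + b * (y' - y) ≤ 0 := by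
  obtain ⟨u, hu⟩ : ∃ u, u = s + (ri+rj)/2 := ⟨_, rfl⟩
  obtain ⟨u', hu'⟩ : ∃ u, u = s' + (ri+rj)/2 := ⟨_, rfl⟩
  rw [← hu] at e
  rw [← hu'] at e'
  have p : 0 < u := by linarith
  have p' : 0 < u' := by linarith
  have a1 : |y| ≤ t * u := by
    apply abs_le_of_sq_le_sq _ (by positivity)
    have : 0 ≤ d^2*t^2/4 := by positivity
    nlinarith
  have a2 : |y'| ≤ t * u' := by
    apply abs_le_of_sq_le_sq _ (by positivity)
    have : 0 ≤ d^2*t^2/4 := by positivity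
    nlinarith
  rw [abs_le] at a1 a2
  have f : (t * (u' - u)) * (t * (u' + u)) = (y' - y) * (y' + y) := by
    linear_combination e - e'
  have hp : 0 < t * (u' + u) := by positivity
  have b1 : t * (u'-u) ≤ y' - y := by
    apply le_of_mul_le_mul_right _ hp
    rw [f]
    exact mul_le_mul_of_nonneg_left (by linarith) (by linarith)
  have b2 : -(y' - y) ≤ t * (u'-u) := by
    apply le_of_mul_le_mul_right _ hp
    rw [f]
    nlinarith
  have hs : s' - s = u' - u := by linarith
  rw [hs]
  have : t * (m * (u'-u) + b * (y'-y)) ≤ 0 := by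
    have hy : 0 < y' - y := by linarith
    rcases le_total 0 m with hm | hm
    · nlinarith
    · nlinarith
  by_contra hh
  push Not at hh
  have := mul_pos ht hh
  linarith

lemma bis_x (d c t ri rj x y s : ℝ) (hd : 0 < d) (hct : c^2+t^2=1) (hc : c * d = ri - rj)
    (h1 : (s+ri)^2 = x^2+y^2) (h2 : (s+rj)^2 = (x-d)^2+y^2) :
    x = d/2 + c * (s + (ri+rj)/2) ∧ y^2 = t^2 * (s + (ri+rj)/2)^2 - d^2*t^2/4 := by
  have hx : x = d/2 + c * (s + (ri+rj)/2) := by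
    apply mul_left_cancel₀ hd.ne'
    linear_combination (h2 - h1)/2 - (s + (ri+rj)/2) * hc
  refine ⟨hx, ?_⟩
  have e1 : ri = (ri+rj)/2 + c*d/2 := by linarith
  have e2 : y^2 = (s + (ri+rj)/2 + c*d/2)^2 - x^2 := by
    have : s + (ri+rj)/2 + c*d/2 = s + ri := by linarith
    rw [this]; linarith
  rw [e2, hx]
  linear_combination (d^2/4 - (s + (ri+rj)/2)^2) * hct

/-- monotonicity: with `Dh` between `Di` and `Dj` ccw, and `Dk, Dk'` between
`Dj` and `Di` ccw, equidistant points `vijk ≺ vijk'` on the bisector, if `Dh` is disjoint from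
the tangent disk `D_ijk` then it is disjoint from `D_ijk'`. -/
theorem stmt9 (𝒟 : Set Disk) (hfin : 𝒟.Finite) (hsc : StronglyConvexPos 𝒟)
    (Di Dj Dh Dk Dk' : Disk)
    (hi : Di ∈ 𝒟) (hj : Dj ∈ 𝒟) (hh : Dh ∈ 𝒟) (hk : Dk ∈ 𝒟) (hk' : Dk' ∈ 𝒟)
    (hy : Di.center 1 = Dj.center 1) (hx : Di.center 0 < Dj.center 0)
    (hsch : StronglyConvexIndep {Di, Dj, Dh})
    (hsck : StronglyConvexIndep {Di, Dj, Dk})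
    (hsck' : StronglyConvexIndep {Di, Dj, Dk'})
    (hbh : CCWBetween 𝒟 Di Dh Dj)
    (hbk : CCWBetween 𝒟 Dj Dk Di) (hbk' : CCWBetween 𝒟 Dj Dk' Di)
    (vijh vijk vijk' : Pt)
    (hvh : Di.sd vijh = Dj.sd vijh ∧ Dj.sd vijh = Dh.sd vijh)
    (hvk : Di.sd vijk = Dj.sd vijk ∧ Dj.sd vijk = Dk.sd vijk)
    (hvk' : Di.sd vijk' = Dj.sd vijk' ∧ Dj.sd vijk' = Dk'.sd vijk')
    (hlt : vijk 1 < vijk' 1)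
    (hdisj : Dh.Disj ⟨vijk, Di.sd vijk⟩) :
    Dh.Disj ⟨vijk', Di.sd vijk'⟩ := by
  have rad : ∀ D ∈ 𝒟, 0 ≤ D.radius := by
    intro D hD
    obtain ⟨q, hq⟩ := (hsc D hD).1
    have : dist q D.center = D.radius := hq.1
    rw [← this]; exact dist_nonneg
  obtain ⟨o, -, hoo⟩ := hbh
  obtain ⟨x, hx0⟩ := (hsc Di hi).1
  obtain ⟨y, hy0⟩ := (hsc Dh hh).1
  obtain ⟨z, hz0⟩ := (hsc Dj hj).1
  have ccw := hoo x hx0 y hy0 z hz0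
  have nij : Di ≠ Dj := by rintro rfl; exact lt_irrefl _ hx
  have nih : Di ≠ Dh := by
    rintro rfl
    have := (hoo x hx0 x hx0 z hz0).1
    unfold cross at this; linarith
  have njh : Dj ≠ Dh := by
    rintro rfl
    have := (hoo x hx0 z hz0 z hz0).2.1
    unfold cross at this; linarith
  obtain ⟨T, hTdef⟩ : ∃ T : Set Disk, T = {Di, Dj, Dh} := ⟨_, rfl⟩
  rw [← hTdef] at hsch
  have hTi : Di ∈ T := by rw [hTdef]; simp
  have hTj : Dj ∈ T := by rw [hTdef]; simp
  have hTh : Dh ∈ T := by rw [hTdef]; simp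
  have hT3 : ∀ E ∈ T, E = Di ∨ E = Dj ∨ E = Dh := by
    intro E hE; rw [hTdef] at hE; simpa using hE
  have hT : T ⊆ 𝒟 := by
    intro E hE
    rcases hT3 E hE with rfl | rfl | rfl <;> assumption
  have hx1 := arc_mono hT hTi hx0
  have hy1 := arc_mono hT hTh hy0
  have hz1 := arc_mono hT hTj hz0
  have ho : o ∈ interior (diskHull T) :=
    tri_int (convex_convexHull ℝ _) o x y z (pts_subset T _ hTi (arc_pts hx1))
      (pts_subset T _ hTh (arc_pts hy1)) (pts_subset T _ hTj (arc_pts hz1)) ccw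
  have hcr : 0 < cross x y z := by
    have e : cross x y z = cross o x y + cross o y z + cross o z x := by unfold cross; ring
    rw [e]; linarith [ccw.1, ccw.2.1, ccw.2.2]
  have ri := rad _ hi
  have rj := rad _ hj
  have rh := rad _ hh
  obtain ⟨d, hd⟩ : ∃ d, d = Dj.center 0 - Di.center 0 := ⟨_, rfl⟩
  have d0 : 0 < d := by linarith
  have dij : dist Di.center Dj.center = d := by
    have := dist_sq' Di.center Dj.center
    rw [hy] at this
    apply (pow_left_inj₀ dist_nonneg d0.le two_ne_zero).1
    rw [this, hd]; ring
  have hdis : Di.radius + Dj.radius < d := by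
    have := hsch.2 _ hTi _ hTj nij
    unfold Disk.Disj at this; linarith
  obtain ⟨c, hc⟩ : ∃ c, c = (Di.radius - Dj.radius) / d := ⟨_, rfl⟩
  have hcd : c * d = Di.radius - Dj.radius := by rw [hc]; field_simp
  have c1 : 0 < 1 - c^2 := by
    have h1 : c < 1 := by rw [hc, div_lt_one d0]; linarith
    have h2 : -1 < c := by rw [hc, lt_div_iff₀ d0]; linarith
    nlinarith
  obtain ⟨t, htd⟩ : ∃ t, t = √(1 - c^2) := ⟨_, rfl⟩
  have t0 : 0 < t := by rw [htd]; exact Real.sqrt_pos.2 c1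
  have hct : c^2 + t^2 = 1 := by rw [htd, Real.sq_sqrt c1.le]; ring
  have C : Cfg T Di Dj Dh o c t :=
    { hT := hT3, hi := hTi, hj := hTj, hh := hTh, rr := fun E hE => rad E (hT hE), ho := ho
      con := fun E hE => (hsch.1 E hE).isPreconnected, ind := hsch.2, nij := nij, nih := nih
      njh := njh, hy := hy, hx := hx, ht := t0, hct := hct, hc := by rw [← hd]; exact hcd }
  obtain ⟨gm, gp⟩ := C.main x y z hx1 hy1 hz1 hcr
  -- the bisector data
  have dat : ∀ v : Pt, Di.sd v = Dj.sd v →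
      d ≤ 2 * Di.sd v + Di.radius + Dj.radius ∧
      v 0 - Di.center 0 = d/2 + c * (Di.sd v + (Di.radius+Dj.radius)/2) ∧
      (v 1 - Di.center 1)^2 = t^2 * (Di.sd v + (Di.radius+Dj.radius)/2)^2 - d^2*t^2/4 := by
    intro v hv
    have e1 : dist v Di.center = Di.sd v + Di.radius := by unfold Disk.sd; ring
    have e2 : dist v Dj.center = Di.sd v + Dj.radius := by rw [hv]; unfold Disk.sd; ring
    have q1 := dist_sq' v Di.center
    have q2 := dist_sq' v Dj.center
    have tr := dist_triangle_left Di.center Dj.center v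
    rw [e1] at q1 tr
    rw [e2] at q2 tr
    rw [dij] at tr
    refine ⟨by linarith, ?_⟩
    refine bis_x d c t Di.radius Dj.radius _ _ _ d0 hct hcd q1 ?_
    rw [q2, ← hy, hd]; ring
  obtain ⟨k1, k2, k3⟩ := dat vijk hvk.1
  obtain ⟨k1', k2', k3'⟩ := dat vijk' hvk'.1
  have fin := bisector d t Di.radius Dj.radius _ _ _ _
    (c * (Dh.center 0 - Di.center 0) + (Dh.radius - Di.radius)) (Dh.center 1 - Di.center 1)
    t0 k1 k1' d0 k3 k3' (by linarith) (by unfold hv at *; linarith) (by unfold hv at *; linarith)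
  unfold Disk.Disj at hdisj ⊢
  simp only at hdisj ⊢
  have e1 : dist vijk Di.center = Di.sd vijk + Di.radius := by unfold Disk.sd; ring
  have e2 : dist vijk' Di.center = Di.sd vijk' + Di.radius := by unfold Disk.sd; ring
  have q1 := dist_sq' vijk Di.center
  have q2 := dist_sq' vijk' Di.center
  rw [e1] at q1
  rw [e2] at q2
  have h1 := dist_sq' Dh.center vijk
  have h2 := dist_sq' Dh.center vijk'
  have dx : vijk' 0 - vijk 0 = c * (Di.sd vijk' - Di.sd vijk) := by linarith
  have hs : 0 ≤ Dh.radius + Di.sd vijk := by linarith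
  have L0 : (Dh.radius + Di.sd vijk)^2 < dist Dh.center vijk ^ 2 :=
    pow_lt_pow_left₀ hdisj hs two_ne_zero
  apply lt_of_pow_lt_pow_left₀ 2 dist_nonneg
  have key : dist Dh.center vijk' ^ 2 - (Dh.radius + Di.sd vijk')^2
      - (dist Dh.center vijk ^ 2 - (Dh.radius + Di.sd vijk)^2)
      = -2 * ((c * (Dh.center 0 - Di.center 0) + (Dh.radius - Di.radius)) *
          (Di.sd vijk' - Di.sd vijk) + (Dh.center 1 - Di.center 1) *
          ((vijk' 1 - Di.center 1) - (vijk 1 - Di.center 1))) := by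
    rw [h1, h2]
    linear_combination q1 - q2 - 2 * (Dh.center 0 - Di.center 0) * dx
  linarith
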